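/- If σ : ℂ → ℂ is an entire function such that for every z ∈ ℂ, σ(z) ≠ 0 and σ(z) ≠ z, then there exists a constant c ∈ ℂ with c ≠ 0 and c ≠ 1 such that σ(z) = c·z for all z ≠ 0; in particular no such entire σ exists, since then σ(0) = 0, a contradiction. Conclude: there is no entire function σ with σ(z) ∉ {0, z} for all z ∈ ℂ. -/

import Mathlib

open Complex

/-- An entire function without zeros has an entire logarithm. -/
lemma exists_entire_log (f : ℂ → ℂ) (hf : Differentiable ℂ f) (h0 : ∀ z, f z ≠ 0) :
    ∃ g : ℂ → ℂ, Differentiable ℂ g ∧ ∀ z, f z = exp (g z) := by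
  have hf' : Differentiable ℂ (deriv f) := fun z =>
    (hf.analyticAt z).deriv.differentiableAt
  have hq : Differentiable ℂ (fun z => deriv f z / f z) := hf'.div hf h0
  obtain ⟨G, hG⟩ := hq.isExactOn_univ
  have hG' : ∀ z, HasDerivAt G (deriv f z / f z) z := fun z => hG z (Set.mem_univ z)
  have hd : ∀ z, HasDerivAt (fun z => f z * exp (-G z)) 0 z := by
    intro z
    have h1 := (hf z).hasDerivAt.fun_mul ((hG' z).fun_neg.cexp)
    have h2 := h0 z
    have h3 : deriv f z * exp (-G z) + f z * (exp (-G z) * -(deriv f z / f z)) = 0 := by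
      field_simp
      ring
    rw [h3] at h1
    exact h1
  have hc : ∀ z, f z * exp (-G z) = f 0 * exp (-G 0) := fun z =>
    is_const_of_deriv_eq_zero (fun z => (hd z).differentiableAt) (fun z => (hd z).deriv) z 0
  have hk : f 0 * exp (-G 0) ≠ 0 := mul_ne_zero (h0 0) (exp_ne_zero _)
  refine ⟨fun z => log (f 0 * exp (-G 0)) + G z,
    (differentiable_const _).add (fun z => (hG' z).differentiableAt), fun z => ?_⟩
  rw [exp_add, exp_log hk, ← hc z, mul_assoc, ← exp_add]
  simp

/-- Local form of Bloch's theorem. -/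
lemma bloch_local (f : ℂ → ℂ) (hf : Differentiable ℂ f) (p : ℂ) (t : ℝ) (ht : 0 < t)
    (hp : deriv f p ≠ 0)
    (hb : ∀ z ∈ Metric.ball p t, ‖deriv f z‖ ≤ 2 * ‖deriv f p‖) :
    Metric.ball (f p) (‖deriv f p‖ * t / 24) ⊆ Set.range f := by
  have hf' : Differentiable ℂ (deriv f) := fun z =>
    (hf.analyticAt z).deriv.differentiableAt
  set M := ‖deriv f p‖ with hM
  have hMpos : 0 < M := norm_pos_iff.mpr hp
  have hS : ∀ z ∈ Metric.closedBall p (t / 6), ‖deriv f z - deriv f p‖ ≤ M / 2 := by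
    intro z hz
    have hz' : dist z p ≤ t / 6 := hz
    have hzb : z ∈ Metric.ball p t := by
      rw [Metric.mem_ball]; linarith
    have := Complex.dist_le_div_mul_dist_of_mapsTo_ball (R₂ := 3 * M)
      hf'.differentiableOn (c := p) (R₁ := t) (fun w hw => by
        rw [Metric.mem_closedBall, dist_eq_norm]
        have h1 := norm_sub_le (deriv f w) (deriv f p)
        have h2 := hb w hw
        linarith) hzb
    rw [← dist_eq_norm]
    refine this.trans ?_
    calc 3 * M / t * dist z p ≤ 3 * M / t * (t / 6) := by gcongr
      _ = M / 2 := by field_simp; norm_num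
  have hE : ∀ z ∈ Metric.closedBall p (t / 6),
      ‖(f z - deriv f p * z) - (f p - deriv f p * p)‖ ≤ M / 2 * ‖z - p‖ := by
    intro z hz
    refine (convex_closedBall p (t / 6)).norm_image_sub_le_of_norm_hasDerivWithin_le
      (f := fun z => f z - deriv f p * z) (f' := fun z => deriv f z - deriv f p) ?_ hS
      (Metric.mem_closedBall_self (by positivity)) hz
    intro x _
    have := ((hf x).hasDerivAt.fun_sub ((hasDerivAt_id x).const_mul (deriv f p)))
    simpa using this.hasDerivWithinAt
  have hL : ∀ z ∈ Metric.closedBall p (t / 6), M / 2 * ‖z - p‖ ≤ ‖f z - f p‖ := by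
    intro z hz
    have h1 := hE z hz
    have h2 : ‖deriv f p * (z - p)‖ = M * ‖z - p‖ := norm_mul _ _
    have h3 : deriv f p * (z - p) =
      (f z - f p) - ((f z - deriv f p * z) - (f p - deriv f p * p)) := by ring
    have h4 := norm_sub_le (f z - f p) ((f z - deriv f p * z) - (f p - deriv f p * p))
    rw [← h3, h2] at h4
    linarith
  have hfin := DiffContOnCl.ball_subset_image_closedBall (f := f) (z₀ := p) (r := t / 6)
    (ε := M * t / 12) hf.diffContOnCl (by positivity) (by
      intro z hz
      have h1 := hL z (Metric.sphere_subset_closedBall hz)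
      have h2 : ‖z - p‖ = t / 6 := by rw [← dist_eq_norm]; exact hz
      rw [h2] at h1
      linarith) (by
      have h1 : ∀ᶠ z in nhdsWithin p {p}ᶜ, f z ≠ f p := by
        have h2 : Metric.closedBall p (t / 6) ∈ nhdsWithin p {p}ᶜ :=
          mem_nhdsWithin_of_mem_nhds (Metric.closedBall_mem_nhds p (by positivity))
        filter_upwards [h2, self_mem_nhdsWithin] with z hz hzp heq
        have h3 := hL z hz
        have h4 : 0 < ‖z - p‖ := norm_pos_iff.mpr (sub_ne_zero.mpr hzp)
        rw [heq, sub_self, norm_zero] at h3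
        have := mul_pos (half_pos hMpos) h4
        linarith
      exact h1.frequently.filter_mono nhdsWithin_le_nhds)
  have he : M * t / 12 / 2 = M * t / 24 := by ring
  rw [he] at hfin
  exact hfin.trans (Set.image_subset_range _ _)

/-- Bloch: the range of a nonconstant entire function contains arbitrarily large discs. -/
lemma bloch_entire (f : ℂ → ℂ) (hf : Differentiable ℂ f) (z₀ : ℂ) (h0 : deriv f z₀ ≠ 0)
    (r : ℝ) (hr : 0 < r) : ∃ w, Metric.ball w r ⊆ Set.range f := by
  have hf' : Differentiable ℂ (deriv f) := fun z =>
    (hf.analyticAt z).deriv.differentiableAt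
  have hM : 0 < ‖deriv f z₀‖ := norm_pos_iff.mpr h0
  set R := 48 * r / ‖deriv f z₀‖ with hR
  have hRpos : 0 < R := by positivity
  have hRM : ‖deriv f z₀‖ * R = 48 * r := by rw [hR]; field_simp
  obtain ⟨p, hp, hmax⟩ := (isCompact_closedBall z₀ R).exists_isMaxOn
    ⟨z₀, Metric.mem_closedBall_self hRpos.le⟩
    (f := fun z => ‖deriv f z‖ * (R - ‖z - z₀‖))
    (by have := hf'.continuous; fun_prop)
  have hmax' : ∀ z ∈ Metric.closedBall z₀ R,
      ‖deriv f z‖ * (R - ‖z - z₀‖) ≤ ‖deriv f p‖ * (R - ‖p - z₀‖) := fun z hz => hmax hz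
  have h1 := hmax' z₀ (Metric.mem_closedBall_self hRpos.le)
  rw [sub_self, norm_zero, sub_zero, hRM] at h1
  have hpR : ‖p - z₀‖ ≤ R := by rw [← dist_eq_norm]; exact hp
  have hprod : 0 < ‖deriv f p‖ * (R - ‖p - z₀‖) := by linarith
  have hs : 0 < R - ‖p - z₀‖ := pos_of_mul_pos_right hprod (norm_nonneg _)
  have hd : 0 < ‖deriv f p‖ := pos_of_mul_pos_left hprod hs.le
  have := bloch_local f hf p ((R - ‖p - z₀‖) / 2) (by positivity) (norm_pos_iff.mp hd) (by
    intro z hz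
    have hz1 : ‖z - p‖ < (R - ‖p - z₀‖) / 2 := by rw [← dist_eq_norm]; exact hz
    have hz2 : ‖z - z₀‖ ≤ ‖z - p‖ + ‖p - z₀‖ := norm_sub_le_norm_sub_add_norm_sub _ _ _
    have hz3 := hmax' z (by rw [Metric.mem_closedBall, dist_eq_norm]; linarith)
    have hz4 : ‖deriv f z‖ * ((R - ‖p - z₀‖) / 2) ≤ ‖deriv f z‖ * (R - ‖z - z₀‖) := by
      gcongr; linarith
    have hz5 := hz4.trans hz3
    by_contra hcon
    push Not at hcon
    have := mul_lt_mul_of_pos_right hcon hs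
    linarith)
  exact ⟨f p, (Metric.ball_subset_ball (by linarith)).trans this⟩

lemma exists_cosh_sq_nonneg (x : ℝ) (hx : 0 ≤ x) :
    ∃ s : ℝ, |s - x| ≤ 1 ∧ ∃ n : ℤ, Real.cosh s ^ 2 = n := by
  have key : Real.cosh x ^ 2 + 1 ≤ Real.cosh (x + 1) ^ 2 := by
    have h1 : (1 : ℝ) ≤ Real.sinh 1 := Real.self_le_sinh_iff.mpr (by norm_num)
    have h2 := Real.one_le_cosh 1
    have h3 : 0 ≤ Real.sinh x := Real.sinh_nonneg_iff.mpr hx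
    have h4 := Real.one_le_cosh x
    have h5 := Real.cosh_sq x
    rw [Real.cosh_add]
    have h6 : Real.cosh x * 1 ≤ Real.cosh x * Real.cosh 1 := by gcongr
    have h7 : Real.sinh x * 1 ≤ Real.sinh x * Real.sinh 1 := by gcongr
    have h8 := Real.cosh_sq 1
    have h9 : 0 ≤ (Real.cosh x * Real.cosh 1) * (Real.sinh x * Real.sinh 1) := by positivity
    have h10 : (Real.cosh x * Real.cosh 1) ^ 2 =
      Real.cosh x ^ 2 + Real.cosh x ^ 2 * Real.sinh 1 ^ 2 := by rw [mul_pow, h8]; ring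
    have h11 : 1 ≤ Real.cosh x ^ 2 * Real.sinh 1 ^ 2 := by
      have : 1 ≤ Real.cosh x ^ 2 := one_le_pow₀ h4
      have : 1 ≤ Real.sinh 1 ^ 2 := one_le_pow₀ h1
      nlinarith
    nlinarith [sq_nonneg (Real.sinh x * Real.sinh 1)]
  have hivt := intermediate_value_Icc (f := fun s => Real.cosh s ^ 2)
    (show x ≤ x + 1 by linarith) (by fun_prop)
  have hm : ((⌈Real.cosh x ^ 2⌉ : ℤ) : ℝ) ∈
      Set.Icc (Real.cosh x ^ 2) (Real.cosh (x + 1) ^ 2) :=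
    ⟨Int.le_ceil _, (Int.ceil_lt_add_one _).le.trans key⟩
  obtain ⟨s, hs, hs'⟩ := hivt hm
  exact ⟨s, by rw [abs_le]; constructor <;> linarith [hs.1, hs.2], _, hs'⟩

lemma exists_cosh_sq (x : ℝ) :
    ∃ s : ℝ, |s - x| ≤ 1 ∧ ∃ n : ℤ, Real.cosh s ^ 2 = n := by
  rcases le_total 0 x with hx | hx
  · exact exists_cosh_sq_nonneg x hx
  · obtain ⟨s, hs, n, hn⟩ := exists_cosh_sq_nonneg (-x) (by linarith)
    refine ⟨-s, ?_, n, by rw [Real.cosh_neg, hn]⟩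
    rw [← abs_neg]
    convert hs using 2
    ring

/-- Every disc of radius 6 contains a point where `cosh ^ 2` is an integer. -/
lemma exists_cosh_int (w : ℂ) :
    ∃ v ∈ Metric.ball w 6, ∃ n : ℤ, Complex.cosh v ^ 2 = n := by
  obtain ⟨s, hs, n, hn⟩ := exists_cosh_sq w.re
  set m : ℤ := ⌊w.im / Real.pi⌋ with hm
  refine ⟨s + (m * Real.pi : ℝ) * I, ?_, n, ?_⟩
  · rw [Metric.mem_ball, dist_eq_norm]
    refine (Complex.norm_le_abs_re_add_abs_im _).trans_lt ?_
    have h1 : |(m * Real.pi : ℝ) - w.im| ≤ Real.pi := by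
      have hpi := Real.pi_pos
      have h2 : (m : ℝ) ≤ w.im / Real.pi := Int.floor_le _
      have h3 : w.im / Real.pi < m + 1 := Int.lt_floor_add_one _
      rw [le_div_iff₀ hpi] at h2
      rw [div_lt_iff₀ hpi] at h3
      rw [abs_le]; constructor <;> linarith
    have h4 := Real.pi_le_four
    simp only [sub_re, add_re, ofReal_re, mul_re, I_re, mul_zero, ofReal_im, I_im, mul_one,
      sub_im, add_im, mul_im, zero_add, add_zero, sub_zero]
    linarith
  · have h1 : Complex.cosh (s + (m * Real.pi : ℝ) * I) ^ 2 = Complex.cosh s ^ 2 := by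
      have h2 : ∀ z : ℂ, Complex.cosh z ^ 2 = (exp (2 * z) + 2 + exp (-(2 * z))) / 4 := by
        intro z
        have h3 : exp z * exp (-z) = 1 := by rw [← exp_add]; simp
        have h4 : exp (2 * z) = exp z ^ 2 := by rw [← exp_nat_mul]; norm_num
        have h5 : exp (-(2 * z)) = exp (-z) ^ 2 := by
          rw [← exp_nat_mul]; congr 1; push_cast; ring
        rw [Complex.cosh, h4, h5]
        linear_combination (1 / 2) * h3
      rw [h2, h2]
      have h6 : exp (2 * (s + (m * Real.pi : ℝ) * I)) = exp (2 * s) := by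
        rw [exp_eq_exp_iff_exists_int]
        exact ⟨m, by push_cast; ring⟩
      rw [exp_neg, exp_neg, h6]
    rw [h1, ← ofReal_cosh]
    exact_mod_cast congrArg (fun x : ℝ => (x : ℂ)) hn

/-- Little Picard theorem for entire functions omitting 0 and 1. -/
lemma little_picard (f : ℂ → ℂ) (hf : Differentiable ℂ f) (h0 : ∀ z, f z ≠ 0)
    (h1 : ∀ z, f z ≠ 1) : ∀ z w, f z = f w := by
  obtain ⟨g₀, hg₀, hfg⟩ := exists_entire_log f hf h0
  have h2pi : (2 * Real.pi * I : ℂ) ≠ 0 := two_pi_I_ne_zero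
  set g : ℂ → ℂ := fun z => g₀ z / (2 * Real.pi * I) with hgdef
  have hg : Differentiable ℂ g := hg₀.div_const _
  have hgn : ∀ z, ∀ n : ℤ, g z ≠ n := by
    intro z n hn
    apply h1 z
    rw [hfg, exp_eq_one_iff]
    exact ⟨n, by rw [← hn, hgdef]; field_simp⟩
  obtain ⟨A, hA, hgA⟩ := exists_entire_log g hg (fun z => by simpa using hgn z 0)
  obtain ⟨B, hB, hgB⟩ := exists_entire_log (fun z => g z - 1) (hg.sub_const 1)
    (fun z => sub_ne_zero.mpr (by simpa using hgn z 1))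
  have hsq : ∀ z : ℂ, exp (z / 2) ^ 2 = exp z := by
    intro z; rw [← exp_nat_mul]; congr 1; push_cast; ring
  have hab : ∀ z, (exp (A z / 2) - exp (B z / 2)) * (exp (A z / 2) + exp (B z / 2)) = 1 := by
    intro z
    have e1 := hsq (A z)
    have e2 := hsq (B z)
    rw [← hgA] at e1
    rw [← hgB] at e2
    linear_combination e1 - e2
  obtain ⟨h, hh, hhe⟩ := exists_entire_log (fun z => exp (A z / 2) - exp (B z / 2))
    (by fun_prop) (fun z => left_ne_zero_of_mul_eq_one (hab z))
  have hgh : ∀ z, g z = Complex.cosh (h z) ^ 2 := by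
    intro z
    have e1 : exp (h z) = exp (A z / 2) - exp (B z / 2) := (hhe z).symm
    have e2 : exp (-h z) = exp (A z / 2) + exp (B z / 2) := by
      rw [exp_neg, e1]
      exact inv_eq_of_mul_eq_one_right (hab z)
    rw [Complex.cosh, e1, e2, hgA, ← hsq]
    ring
  have hder : ∀ z, deriv h z = 0 := by
    intro z
    by_contra hz
    obtain ⟨w, hw⟩ := bloch_entire h hh z hz 6 (by norm_num)
    obtain ⟨v, hv, n, hn⟩ := exists_cosh_int w
    obtain ⟨u, rfl⟩ := hw hv
    exact hgn u n (by rw [hgh, hn])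
  have hconst := is_const_of_deriv_eq_zero hh hder
  intro z w
  have e : g z = g w := by rw [hgh, hgh, hconst z w]
  have eg : g₀ z = g₀ w := by
    simp only [hgdef] at e
    exact (div_left_inj' h2pi).mp e
  rw [hfg, hfg, eg]

/-- There is no entire function `σ` with `σ z ∉ {0, z}` for all `z ∈ ℂ`. -/
theorem no_entire_avoiding_triple_section :
    ¬ ∃ σ : ℂ → ℂ, Differentiable ℂ σ ∧ ∀ z : ℂ, σ z ≠ 0 ∧ σ z ≠ z := by
  rintro ⟨σ, hσ, hz⟩
  have hP := little_picard (fun u => σ (exp u) / exp u)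
    ((hσ.comp differentiable_exp).div differentiable_exp (fun u => exp_ne_zero u))
    (fun u => div_ne_zero (hz _).1 (exp_ne_zero u))
    (fun u hu => (hz (exp u)).2 ((div_eq_one_iff_eq (exp_ne_zero u)).mp hu))
  have hlin : ∀ z : ℂ, z ≠ 0 → σ z = σ 1 * z := by
    intro z hz0
    have := hP (log z) 0
    simp only [exp_log hz0, exp_zero, div_one] at this
    rwa [div_eq_iff hz0] at this
  have heq : σ = fun z => σ 1 * z := by
    refine Continuous.ext_on (dense_compl_singleton (0 : ℂ)) hσ.continuous (by fun_prop) ?_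
    intro z hz0
    exact hlin z hz0
  apply (hz 0).1
  rw [heq]
  simp
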